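/- arXiv:2012.09124 — 6 statements merged into one kernel-verified Lean document; each statement's English description precedes it below -/
import Mathlib

section
/- Let α ∈ ℝ and let R_α : ℝ² → ℝ² be the rotation R_α(x₁, x₂) = (cos α · x₁ − sin α · x₂, sin α · x₁ + cos α · x₂). For every continuous V : ℝ² → ℝ², the function t ↦ ½ ∫₀^{2π} ‖c(θ) + t·V(c(θ)) − R_α(c(θ))‖² dθ is differentiable at t = 0 with derivative ∫₀^{2π} [ (1 − cos α) · ⟨c(θ), V(c(θ))⟩ − sin α · ⟨τ(c(θ)), V(c(θ))⟩ ] dθ, i.e. the pre-shape derivative of the tracking functional with rotated target at the identity embedding of the unit circle decomposes into a normal part with density (1 − cos α) and a tangential part with density −sin α. -/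
open Real
open scoped RealInnerProductSpace

/-- The unit circle parameterization `c(θ) = (cos θ, sin θ)` in `ℝ²`. -/
noncomputable def circleParam (θ : ℝ) : EuclideanSpace ℝ (Fin 2) :=
  (WithLp.equiv 2 (Fin 2 → ℝ)).symm ![Real.cos θ, Real.sin θ]

/-- The unit tangent field `τ(x₁, x₂) = (−x₂, x₁)` on the unit circle. -/
noncomputable def circleTangent (x : EuclideanSpace ℝ (Fin 2)) : EuclideanSpace ℝ (Fin 2) :=
  (WithLp.equiv 2 (Fin 2 → ℝ)).symm ![-(x 1), x 0]

/-- The rotation `R_α(x₁, x₂) = (cos α·x₁ − sin α·x₂, sin α·x₁ + cos α·x₂)`. -/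
noncomputable def rotBy (α : ℝ) (x : EuclideanSpace ℝ (Fin 2)) : EuclideanSpace ℝ (Fin 2) :=
  (WithLp.equiv 2 (Fin 2 → ℝ)).symm
    ![Real.cos α * x 0 - Real.sin α * x 1, Real.sin α * x 0 + Real.cos α * x 1]

/-- Pre-shape derivative of the tracking functional with rotated target
at the identity embedding of the unit circle: it decomposes into a normal
part with density `(1 − cos α)` and a tangential part with density `−sin α`
(the outer normal being `n(c θ) = c θ`). -/
theorem preshape_derivative_circle_rotated_target
    (α : ℝ) (V : EuclideanSpace ℝ (Fin 2) → EuclideanSpace ℝ (Fin 2))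
    (hV : Continuous V) :
    HasDerivAt
      (fun t : ℝ => (1/2) * ∫ θ in (0:ℝ)..(2*π),
        ‖circleParam θ + t • V (circleParam θ) - rotBy α (circleParam θ)‖^2)
      (∫ θ in (0:ℝ)..(2*π),
        (1 - Real.cos α) * ⟪circleParam θ, V (circleParam θ)⟫
          - Real.sin α * ⟪circleTangent (circleParam θ), V (circleParam θ)⟫) 0 := by
  have hc : Continuous circleParam := by
    unfold circleParam
    refine (PiLp.continuous_toLp 2 _).comp ?_
    refine continuous_pi fun i => ?_
    fin_cases i
    · exact Real.continuous_cos
    · exact Real.continuous_sin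
  have hVc : Continuous fun θ => V (circleParam θ) := hV.comp hc
  have hv : ∀ i, Continuous fun θ => V (circleParam θ) i := fun i =>
    (PiLp.continuous_apply 2 _ i).comp hVc
  have hv0 := hv 0
  have hv1 := hv 1
  have e : ∀ t : ℝ, ∀ θ : ℝ,
      ‖circleParam θ + t • V (circleParam θ) - rotBy α (circleParam θ)‖^2
      = ((Real.cos θ - (Real.cos α * Real.cos θ - Real.sin α * Real.sin θ))^2
        + (Real.sin θ - (Real.sin α * Real.cos θ + Real.cos α * Real.sin θ))^2)
        + (2 * t) * ((1 - Real.cos α) * ⟪circleParam θ, V (circleParam θ)⟫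
          - Real.sin α * ⟪circleTangent (circleParam θ), V (circleParam θ)⟫)
        + t^2 * (V (circleParam θ) 0 ^ 2 + V (circleParam θ) 1 ^ 2) := by
    intro t θ
    generalize V (circleParam θ) = w
    simp [EuclideanSpace.norm_sq_eq, Fin.sum_univ_two, PiLp.inner_apply, circleParam,
      circleTangent, rotBy]
    ring
  have hB : Continuous fun θ => ((1 - Real.cos α) * ⟪circleParam θ, V (circleParam θ)⟫
          - Real.sin α * ⟪circleTangent (circleParam θ), V (circleParam θ)⟫) := by
    have : (fun θ => ((1 - Real.cos α) * ⟪circleParam θ, V (circleParam θ)⟫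
          - Real.sin α * ⟪circleTangent (circleParam θ), V (circleParam θ)⟫))
        = fun θ => (1 - Real.cos α) * (Real.cos θ * V (circleParam θ) 0
            + Real.sin θ * V (circleParam θ) 1)
          - Real.sin α * (-Real.sin θ * V (circleParam θ) 0
            + Real.cos θ * V (circleParam θ) 1) := by
      funext θ
      generalize V (circleParam θ) = w
      simp [Fin.sum_univ_two, PiLp.inner_apply, circleParam, circleTangent]
      ring
    rw [this]
    fun_prop
  have hA : Continuous fun θ : ℝ =>
      ((Real.cos θ - (Real.cos α * Real.cos θ - Real.sin α * Real.sin θ))^2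
        + (Real.sin θ - (Real.sin α * Real.cos θ + Real.cos α * Real.sin θ))^2) := by
    fun_prop
  have hC : Continuous fun θ : ℝ =>
      (V (circleParam θ) 0 ^ 2 + V (circleParam θ) 1 ^ 2) := by
    fun_prop
  simp_rw [e]
  have e2 : ∀ t : ℝ, ∀ A B C : ℝ → ℝ, Continuous A → Continuous B → Continuous C →
      (∫ θ in (0:ℝ)..(2*π), A θ + (2 * t) * B θ + t^2 * C θ)
      = (∫ θ in (0:ℝ)..(2*π), A θ) + (2 * t) * (∫ θ in (0:ℝ)..(2*π), B θ)
        + t^2 * ∫ θ in (0:ℝ)..(2*π), C θ := by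
    intro t A B C hA hB hC
    rw [intervalIntegral.integral_add
        ((by fun_prop : Continuous fun θ => A θ + (2 * t) * B θ).intervalIntegrable _ _)
        ((by fun_prop : Continuous fun θ => t^2 * C θ).intervalIntegrable _ _),
      intervalIntegral.integral_add (hA.intervalIntegrable _ _)
        ((by fun_prop : Continuous fun θ => (2 * t) * B θ).intervalIntegrable _ _),
      intervalIntegral.integral_const_mul, intervalIntegral.integral_const_mul]
  have e3 := fun t => e2 t _ _ _ hA hB hC
  simp only [e3]
  have e4 : ∀ a b d : ℝ, HasDerivAt
      (fun t : ℝ => (1/2) * (a + (2 * t) * b + t^2 * d)) b 0 := by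
    intro a b d
    have h1 := (((hasDerivAt_id (0:ℝ)).const_mul 2).mul_const b).const_add a
    have h2 := ((hasDerivAt_id (0:ℝ)).pow 2).mul_const d
    have h3 := (h1.add h2).const_mul (1/2 : ℝ)
    have h4 := h3.congr_deriv (show _ = b by simp)
    exact h4
  exact e4 _ _ _
end

section
/- Let Ω ⊆ ℝⁿ be open and bounded, let V : ℝⁿ → ℝⁿ be continuously differentiable, and let f : ℝ × ℝⁿ → ℝ be continuously differentiable. Then the function t ↦ ∫_Ω f(t, x + t·V(x)) · det(I + t·DV(x)) dx is differentiable at t = 0 with derivative ∫_Ω [ ∂f/∂t(0, x) + ⟨∇_x f(0, x), V(x)⟩ + f(0, x) · div V(x) ] dx. -/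
open MeasureTheory
open scoped RealInnerProductSpace

/-- The Jacobian matrix of a map `V : ℝⁿ → ℝⁿ` at `x`, i.e. the matrix of the
Fréchet derivative `DV(x)` in the standard basis. -/
noncomputable def jacMatrix {n : ℕ} (V : EuclideanSpace ℝ (Fin n) → EuclideanSpace ℝ (Fin n))
    (x : EuclideanSpace ℝ (Fin n)) : Matrix (Fin n) (Fin n) ℝ :=
  LinearMap.toMatrix (EuclideanSpace.basisFun (Fin n) ℝ).toBasis
    (EuclideanSpace.basisFun (Fin n) ℝ).toBasis (fderiv ℝ V x)

/-- `(t, M) ↦ det (1 + t M)`, on plain functions (which carry a norm). -/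
noncomputable def detPath (n : ℕ) (p : ℝ × (Fin n → Fin n → ℝ)) : ℝ :=
  (1 + p.1 • (Matrix.of p.2)).det

theorem detPath_contDiff (n : ℕ) : ContDiff ℝ 1 (detPath n) := by
  unfold detPath
  simp only [Matrix.det_apply', Matrix.add_apply, Matrix.smul_apply, Matrix.of_apply, smul_eq_mul]
  refine ContDiff.sum fun σ _ => contDiff_const.mul (contDiff_prod fun i _ => ?_)
  exact contDiff_const.add (contDiff_fst.mul
    ((contDiff_apply_apply ℝ ℝ (σ i) i).comp contDiff_snd))

theorem detPath_hasDerivAt (n : ℕ) (M : Fin n → Fin n → ℝ) (t : ℝ) :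
    HasDerivAt (fun s => detPath n (s, M)) (fderiv ℝ (detPath n) (t, M) (1, 0)) t := by
  have h := ((detPath_contDiff n).differentiable one_ne_zero (t, M)).hasFDerivAt
  exact h.comp_hasDerivAt t ((hasDerivAt_id t).prodMk (hasDerivAt_const t M))

theorem detPath_fderiv_zero (n : ℕ) (M : Fin n → Fin n → ℝ) :
    fderiv ℝ (detPath n) (0, M) (1, 0) = (Matrix.of M).trace := by
  refine (detPath_hasDerivAt n M 0).unique ?_
  have h0 : (fun s => detPath n (s, M)) = fun s => _ :=
    funext fun s => Matrix.det_one_add_smul s (Matrix.of M)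
  rw [h0]
  have h1 : HasDerivAt (fun s : ℝ => 1 + (Matrix.of M).trace * s) ((Matrix.of M).trace) 0 := by
    simpa using ((hasDerivAt_id (0:ℝ)).const_mul (Matrix.of M).trace).const_add 1
  have h2 := (((Polynomial.hasDerivAt
    (Matrix.det (1 + (Polynomial.X : Polynomial ℝ) • (Matrix.of M).map Polynomial.C)).divX.divX
      (0:ℝ))).mul ((hasDerivAt_id (0:ℝ)).pow 2))
  have h3 := h1.add h2
  simp only [id, Pi.pow_apply] at h3
  refine HasDerivAt.congr_deriv (f := fun s => _) h3 ?_
  simp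

theorem jacMatrix_continuous {n : ℕ}
    (V : EuclideanSpace ℝ (Fin n) → EuclideanSpace ℝ (Fin n)) (hV : ContDiff ℝ 1 V) :
    Continuous (fun x => (fun i j => jacMatrix V x i j)) := by
  refine continuous_pi fun i => continuous_pi fun j => ?_
  have h := hV.continuous_fderiv one_ne_zero
  simp only [jacMatrix, LinearMap.toMatrix_apply]
  simp
  fun_prop

/-- Pre-shape material derivative rule for volume integrals: the pullback
`t ↦ ∫_Ω f(t, x + t·V(x)) · det(I + t·DV(x)) dx` of `∫_{T_t(Ω)} f(t, y) dy`
under the perturbation of identity `T_t = id + t·V` is differentiable at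
`t = 0` with derivative `∫_Ω ∂f/∂t(0,x) + ⟨∇ₓf(0,x), V(x)⟩ + f(0,x)·div V(x) dx`. -/
theorem material_derivative_volume_integral {n : ℕ}
    (Ω : Set (EuclideanSpace ℝ (Fin n))) (hΩ : IsOpen Ω) (hΩb : Bornology.IsBounded Ω)
    (V : EuclideanSpace ℝ (Fin n) → EuclideanSpace ℝ (Fin n)) (hV : ContDiff ℝ 1 V)
    (f : ℝ × EuclideanSpace ℝ (Fin n) → ℝ) (hf : ContDiff ℝ 1 f) :
    HasDerivAt
      (fun t : ℝ => ∫ x in Ω, f (t, x + t • V x) * (1 + t • jacMatrix V x).det)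
      (∫ x in Ω,
        deriv (fun s : ℝ => f (s, x)) 0
          + ⟪gradient (fun y => f (0, y)) x, V x⟫
          + f (0, x) * (jacMatrix V x).trace) 0 := by
  set J : EuclideanSpace ℝ (Fin n) → Fin n → Fin n → ℝ := fun x i j => jacMatrix V x i j with hJ
  have hJc : Continuous J := jacMatrix_continuous V hV
  have hVc : Continuous V := hV.continuous
  have hfc : Continuous f := hf.continuous
  have hfd : Continuous (fderiv ℝ f) := hf.continuous_fderiv one_ne_zero
  have hdc : Continuous (detPath n) := (detPath_contDiff n).continuous
  have hdd : Continuous (fderiv ℝ (detPath n)) :=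
    (detPath_contDiff n).continuous_fderiv one_ne_zero
  let F : ℝ → EuclideanSpace ℝ (Fin n) → ℝ := fun t x => f (t, x + t • V x) * detPath n (t, J x)
  let Fd : ℝ → EuclideanSpace ℝ (Fin n) → ℝ := fun t x =>
    fderiv ℝ f (t, x + t • V x) (1, V x) * detPath n (t, J x)
      + f (t, x + t • V x) * fderiv ℝ (detPath n) (t, J x) (1, 0)
  have hFc : ∀ t, Continuous (F t) := fun t => by simp only [F]; fun_prop
  have hFdc : Continuous (fun p : ℝ × EuclideanSpace ℝ (Fin n) => Fd p.1 p.2) := by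
    simp only [Fd]; fun_prop
  have hcomp : IsCompact (closure Ω) := hΩb.isCompact_closure
  have hfin : volume Ω < ⊤ := hΩb.measure_lt_top
  obtain ⟨C, hC⟩ := ((isCompact_Icc (a := (-1:ℝ)) (b := 1)).prod hcomp).exists_bound_of_continuousOn
    hFdc.continuousOn
  have key := (hasDerivAt_integral_of_dominated_loc_of_deriv_le (μ := volume.restrict Ω)
    (F := F) (F' := Fd) (x₀ := (0:ℝ)) (s := Set.Icc (-1:ℝ) 1) (bound := fun _ => C)
    (Icc_mem_nhds (by norm_num) (by norm_num))
    (Filter.Eventually.of_forall fun t => (hFc t).aestronglyMeasurable)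
    (((hFc 0).continuousOn.integrableOn_compact hcomp).mono_set subset_closure)
    ((hFdc.comp (Continuous.prodMk_right (0:ℝ))).aestronglyMeasurable)
    ((ae_restrict_mem hΩ.measurableSet).mono fun x hx t ht =>
      hC (t, x) ⟨ht, subset_closure hx⟩)
    (integrableOn_const hfin.ne)
    (Filter.Eventually.of_forall fun x t _ => ?_)).2
  · have hEq : ∀ x, Fd 0 x = deriv (fun s : ℝ => f (s, x)) 0
          + ⟪gradient (fun y => f (0, y)) x, V x⟫
          + f (0, x) * (jacMatrix V x).trace := by
      intro x
      have hfx := (hf.differentiable one_ne_zero (0, x)).hasFDerivAt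
      have h1 : deriv (fun s : ℝ => f (s, x)) 0 = fderiv ℝ f (0, x) (1, 0) :=
        (hfx.comp_hasDerivAt (0:ℝ)
          ((hasDerivAt_id (0:ℝ)).prodMk (hasDerivAt_const (0:ℝ) x))).deriv
      have h2 : ⟪gradient (fun y => f (0, y)) x, V x⟫ = fderiv ℝ f (0, x) (0, V x) := by
        have h3 : HasFDerivAt (fun y => f (0, y)) _ x :=
          hfx.comp x (hasFDerivAt_prodMk_right (𝕜 := ℝ) (0:ℝ) x)
        rw [gradient, InnerProductSpace.toDual_symm_apply, h3.fderiv]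
        simp
      have h4 : ((1:ℝ), V x) = (1, 0) + (0, V x) := by simp
      have h5 : detPath n (0, J x) = 1 := by simp [detPath]
      have h6 : fderiv ℝ (detPath n) (0, J x) (1, 0) = (jacMatrix V x).trace :=
        detPath_fderiv_zero n (J x)
      simp only [Fd, zero_smul, add_zero]
      rw [h1, h2, h5, h6, h4, map_add, mul_one]
    simp only [hEq] at key
    exact key
  · have hfx := (hf.differentiable one_ne_zero (t, x + t • V x)).hasFDerivAt
    have h0 : HasDerivAt (fun s : ℝ => (s, x + s • V x)) (1, V x) t := by
      refine (hasDerivAt_id t).prodMk ?_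
      simpa using ((hasDerivAt_id t).smul_const (V x)).const_add x
    exact (hfx.comp_hasDerivAt t h0).mul (detPath_hasDerivAt n (J x) t)
end

section
/- Let γ : ℝ → ℝ² be a continuously differentiable, 2π-periodic curve with γ'(θ) ≠ 0 for all θ (a regular parameterized closed curve), let g : ℝ → ℝ be continuous and 2π-periodic, let f : ℝ² → ℝ and V : ℝ² → ℝ² be continuously differentiable, and set τ(θ) = γ'(θ)/‖γ'(θ)‖. Then the function t ↦ ½ ∫₀^{2π} ( g(θ)/‖γ'(θ) + t·DV(γ(θ))γ'(θ)‖ − f( γ(θ) + t·V(γ(θ)) ) )² · ‖γ'(θ) + t·DV(γ(θ))γ'(θ)‖ dθ is differentiable at t = 0 with derivative − ∫₀^{2π} [ ½ ( g(θ)²/‖γ'(θ)‖² − f(γ(θ))² ) · ⟨τ(θ), DV(γ(θ)) τ(θ)⟩ + ( g(θ)/‖γ'(θ)‖ − f(γ(θ)) ) · ⟨∇f(γ(θ)), V(γ(θ))⟩ ] · ‖γ'(θ)‖ dθ. -/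
open Real
open scoped RealInnerProductSpace

open MeasureTheory Set Filter Topology in
/-- Differentiation under the integral over a compact interval, with regularity only near the
slice `t = 0`. -/
lemma hasDerivAt_integral_of_local {F F' : ℝ → ℝ → ℝ} {a b : ℝ} (hab : a ≤ b) (U : Set (ℝ × ℝ))
    (hU : IsOpen U) (h0 : ∀ θ, ((0:ℝ), θ) ∈ U)
    (hF : ContinuousOn (fun p : ℝ × ℝ => F p.1 p.2) U)
    (hF' : ContinuousOn (fun p : ℝ × ℝ => F' p.1 p.2) U)
    (hd : ∀ t θ, (t, θ) ∈ U → HasDerivAt (fun t => F t θ) (F' t θ) t) :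
    HasDerivAt (fun t => ∫ θ in a..b, F t θ) (∫ θ in a..b, F' 0 θ) 0 := by
  obtain ⟨u, v, hu, hv, hu0, hvK, huv⟩ := generalized_tube_lemma (isCompact_singleton (x := (0:ℝ)))
    (isCompact_Icc (a := a) (b := b)) hU (by
      rintro ⟨t, θ⟩ ⟨ht, -⟩
      simp only [mem_singleton_iff] at ht
      subst ht
      exact h0 θ)
  have hu0' : u ∈ 𝓝 (0:ℝ) := hu.mem_nhds (hu0 rfl)
  obtain ⟨r, hr, hru⟩ := Metric.nhds_basis_closedBall.mem_iff.1 hu0'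
  have hsub : Metric.closedBall (0:ℝ) r ×ˢ Icc a b ⊆ U := (prod_mono hru hvK).trans huv
  have hcomp : IsCompact (Metric.closedBall (0:ℝ) r ×ˢ Icc a b) :=
    (isCompact_closedBall _ _).prod isCompact_Icc
  obtain ⟨C, hC⟩ := hcomp.exists_bound_of_continuousOn (hF'.mono hsub)
  have hslice : ∀ (G : ℝ → ℝ → ℝ), ContinuousOn (fun p : ℝ × ℝ => G p.1 p.2) U →
      ∀ t ∈ Metric.closedBall (0:ℝ) r, ContinuousOn (G t) (Icc a b) := by
    intro G hG t ht
    exact (hG.mono hsub).comp (f := fun θ => (t, θ)) (by fun_prop) (fun θ hθ => ⟨ht, hθ⟩)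
  have h0r : (0:ℝ) ∈ Metric.closedBall (0:ℝ) r := Metric.mem_closedBall_self hr.le
  have hI : Set.uIoc a b ⊆ Icc a b := by rw [uIoc_of_le hab]; exact Ioc_subset_Icc_self
  refine (intervalIntegral.hasDerivAt_integral_of_dominated_loc_of_deriv_le
    (s := Metric.closedBall (0:ℝ) r) (bound := fun _ => C) (F := F) (F' := F')
    (Metric.closedBall_mem_nhds _ hr) ?_ ?_ ?_ ?_ ?_ ?_).2
  · filter_upwards [Metric.closedBall_mem_nhds (0:ℝ) hr] with t ht
    exact ((hslice F hF t ht).mono hI).aestronglyMeasurable measurableSet_uIoc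
  · apply ContinuousOn.intervalIntegrable
    rw [uIcc_of_le hab]
    exact hslice F hF 0 h0r
  · exact ((hslice F' hF' 0 h0r).mono hI).aestronglyMeasurable measurableSet_uIoc
  · exact ae_of_all _ fun θ hθ t ht => hC (t, θ) ⟨ht, hI hθ⟩
  · exact intervalIntegrable_const
  · exact ae_of_all _ fun θ hθ t ht => hd t θ (hsub ⟨ht, hI hθ⟩)

/-- Pre-shape derivative of the parameterization tracking functional for a
regular closed curve `γ` in the plane: with unit tangent
`τ(θ) = γ'(θ)/‖γ'(θ)‖`, tangential divergence `⟨τ, DV(γ) τ⟩`, initial density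
`g` and shape-independent ambient target `f`, the functional of the
perturbation of identity is differentiable at `t = 0` with the stated
derivative. -/
theorem preshape_derivative_tracking_closed_curve
    (γ : ℝ → EuclideanSpace ℝ (Fin 2)) (hγ : ContDiff ℝ 1 γ)
    (hγper : Function.Periodic γ (2*π)) (hγreg : ∀ θ, deriv γ θ ≠ 0)
    (g : ℝ → ℝ) (hg : Continuous g) (hgper : Function.Periodic g (2*π))
    (f : EuclideanSpace ℝ (Fin 2) → ℝ) (hf : ContDiff ℝ 1 f)
    (V : EuclideanSpace ℝ (Fin 2) → EuclideanSpace ℝ (Fin 2)) (hV : ContDiff ℝ 1 V)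
    (τ : ℝ → EuclideanSpace ℝ (Fin 2)) (hτ : ∀ θ, τ θ = ‖deriv γ θ‖⁻¹ • deriv γ θ) :
    HasDerivAt
      (fun t : ℝ => (1/2) * ∫ θ in (0:ℝ)..(2*π),
        (g θ / ‖deriv γ θ + t • fderiv ℝ V (γ θ) (deriv γ θ)‖
            - f (γ θ + t • V (γ θ)))^2
          * ‖deriv γ θ + t • fderiv ℝ V (γ θ) (deriv γ θ)‖)
      (-∫ θ in (0:ℝ)..(2*π),
        ((1/2) * ((g θ)^2 / ‖deriv γ θ‖^2 - (f (γ θ))^2)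
            * ⟪τ θ, fderiv ℝ V (γ θ) (τ θ)⟫
          + (g θ / ‖deriv γ θ‖ - f (γ θ)) * ⟪gradient f (γ θ), V (γ θ)⟫)
          * ‖deriv γ θ‖) 0 := by
  have hγ' : Continuous (deriv γ) := hγ.continuous_deriv le_rfl
  have hγc : Continuous γ := hγ.continuous
  have hVc : Continuous V := hV.continuous
  have hfc : Continuous f := hf.continuous
  have hDV : Continuous (fun θ => fderiv ℝ V (γ θ) (deriv γ θ)) :=
    ((hV.continuous_fderiv (by norm_num)).comp hγc).clm_apply hγ'
  have hDf : Continuous (fderiv ℝ f) := hf.continuous_fderiv (by norm_num)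
  have hfd : Differentiable ℝ f := hf.differentiable (by norm_num)
  obtain ⟨W, hW⟩ : ∃ W : ℝ → EuclideanSpace ℝ (Fin 2),
    W = fun θ => fderiv ℝ V (γ θ) (deriv γ θ) := ⟨_, rfl⟩
  have hWc : Continuous W := hW ▸ hDV
  have hWθ : ∀ θ, fderiv ℝ V (γ θ) (deriv γ θ) = W θ := fun θ => by rw [hW]
  obtain ⟨A, hA⟩ : ∃ A, A = deriv γ := ⟨_, rfl⟩
  simp only [hτ, map_smul, hWθ]
  simp only [← hA] at hγreg hγ' ⊢
  have hw : Continuous (fun p : ℝ × ℝ => A p.2 + p.1 • W p.2) := by fun_prop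
  have key := hasDerivAt_integral_of_local (a := 0) (b := 2 * π) (by positivity)
    (F := fun t θ => (g θ / ‖A θ + t • W θ‖ - f (γ θ + t • V (γ θ)))^2 * ‖A θ + t • W θ‖)
    (F' := fun t θ =>
      2 * (g θ / ‖A θ + t • W θ‖ - f (γ θ + t • V (γ θ)))
        * (-(g θ * (⟪A θ + t • W θ, W θ⟫ / ‖A θ + t • W θ‖)) / ‖A θ + t • W θ‖^2
            - fderiv ℝ f (γ θ + t • V (γ θ)) (V (γ θ))) * ‖A θ + t • W θ‖
        + (g θ / ‖A θ + t • W θ‖ - f (γ θ + t • V (γ θ)))^2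
          * (⟪A θ + t • W θ, W θ⟫ / ‖A θ + t • W θ‖))
    {p : ℝ × ℝ | A p.2 + p.1 • W p.2 ≠ 0} (isOpen_ne_fun hw continuous_const)
    (by intro θ; simpa using hγreg θ) ?_ ?_ ?_
  · have := key.const_mul (1/2)
    refine this.congr_deriv ?_
    rw [← intervalIntegral.integral_const_mul, ← intervalIntegral.integral_neg]
    congr 1
    ext θ
    have hN : ‖A θ‖ ≠ 0 := norm_ne_zero_iff.2 (hγreg θ)
    have hgrad : ⟪gradient f (γ θ), V (γ θ)⟫ = fderiv ℝ f (γ θ) (V (γ θ)) := by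
      simp [gradient]
    simp only [zero_smul, add_zero, hgrad, real_inner_smul_left, real_inner_smul_right]
    field_simp
    ring
  · have hNne : ∀ p ∈ {p : ℝ × ℝ | A p.2 + p.1 • W p.2 ≠ 0}, ‖A p.2 + p.1 • W p.2‖ ≠ 0 :=
      fun p hp => norm_ne_zero_iff.2 hp
    have h1 : Continuous (fun p : ℝ × ℝ => ‖A p.2 + p.1 • W p.2‖) := hw.norm
    have h2 : Continuous (fun p : ℝ × ℝ => f (γ p.2 + p.1 • V (γ p.2))) := by fun_prop
    have h3 : ContinuousOn (fun p : ℝ × ℝ => g p.2 / ‖A p.2 + p.1 • W p.2‖)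
      {p : ℝ × ℝ | A p.2 + p.1 • W p.2 ≠ 0} :=
      ContinuousOn.div (by fun_prop) h1.continuousOn hNne
    exact ((h3.sub h2.continuousOn).pow 2).mul h1.continuousOn
  · have hNne : ∀ p ∈ {p : ℝ × ℝ | A p.2 + p.1 • W p.2 ≠ 0}, ‖A p.2 + p.1 • W p.2‖ ≠ 0 :=
      fun p hp => norm_ne_zero_iff.2 hp
    have h1 : Continuous (fun p : ℝ × ℝ => ‖A p.2 + p.1 • W p.2‖) := hw.norm
    have h2 : Continuous (fun p : ℝ × ℝ => f (γ p.2 + p.1 • V (γ p.2))) := by fun_prop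
    have h3 : ContinuousOn (fun p : ℝ × ℝ => g p.2 / ‖A p.2 + p.1 • W p.2‖)
      {p : ℝ × ℝ | A p.2 + p.1 • W p.2 ≠ 0} :=
      ContinuousOn.div (by fun_prop) h1.continuousOn hNne
    have h4 : ContinuousOn (fun p : ℝ × ℝ => ⟪A p.2 + p.1 • W p.2, W p.2⟫
        / ‖A p.2 + p.1 • W p.2‖) {p : ℝ × ℝ | A p.2 + p.1 • W p.2 ≠ 0} :=
      ContinuousOn.div (Continuous.continuousOn (hw.inner (by fun_prop))) h1.continuousOn hNne
    have h5 : Continuous (fun p : ℝ × ℝ =>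
        fderiv ℝ f (γ p.2 + p.1 • V (γ p.2)) (V (γ p.2))) :=
      (hDf.comp (by fun_prop : Continuous fun p : ℝ × ℝ => γ p.2 + p.1 • V (γ p.2))).clm_apply
        (by fun_prop)
    have hgo : ContinuousOn (fun p : ℝ × ℝ => g p.2) {p : ℝ × ℝ | A p.2 + p.1 • W p.2 ≠ 0} := by
      fun_prop
    have h6 := h3.sub h2.continuousOn
    have h7 := ((hgo.mul h4).neg.div (h1.continuousOn.pow 2)
      (fun p hp => pow_ne_zero 2 (hNne p hp))).sub h5.continuousOn
    exact (((continuousOn_const.mul h6).mul h7).mul h1.continuousOn).add ((h6.pow 2).mul h4)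
  · intro t θ hp
    have hne : A θ + t • W θ ≠ 0 := hp
    have hN : ‖A θ + t • W θ‖ ≠ 0 := norm_ne_zero_iff.2 hne
    have hl : HasDerivAt (fun t : ℝ => A θ + t • W θ) (W θ) t := by
      simpa using ((hasDerivAt_id t).smul_const (W θ)).const_add (A θ)
    have hl2 : HasDerivAt (fun t : ℝ => γ θ + t • V (γ θ)) (V (γ θ)) t := by
      simpa using ((hasDerivAt_id t).smul_const (V (γ θ))).const_add (γ θ)
    have hNd : HasDerivAt (fun t : ℝ => ‖A θ + t • W θ‖)
        (⟪A θ + t • W θ, W θ⟫ / ‖A θ + t • W θ‖) t := by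
      have := hl.norm_sq.sqrt (pow_ne_zero 2 hN)
      simp only [Real.sqrt_sq (norm_nonneg _)] at this
      refine this.congr_deriv ?_
      field_simp
    have hfd' := (hfd (γ θ + t • V (γ θ))).hasFDerivAt.comp_hasDerivAt t hl2
    have hq := ((hasDerivAt_const t (g θ)).div hNd hN).sub hfd'
    refine ((hq.pow 2).mul hNd).congr_deriv ?_
    simp
end

section
/- Let Ω ⊆ ℝⁿ be open, bounded and connected, and let u, f : ℝⁿ → ℝ be continuously differentiable with u(x) > 0 for all x ∈ Ω and ∫_Ω u dx = ∫_Ω f dx. Then the following are equivalent: (i) for every smooth V : ℝⁿ → ℝⁿ with compact support contained in Ω, ∫_Ω [ ½ ( u(x)² − f(x)² ) · div V(x) + ( u(x) − f(x) ) · ⟨∇f(x), V(x)⟩ ] dx = 0; (ii) u(x) = f(x) for all x ∈ Ω. In particular, stationarity of the parameterization tracking functional with respect to all compactly supported interior directions already characterizes its global minimizers. -/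
open MeasureTheory
open scoped RealInnerProductSpace

/-- Divergence of a scalar function times a constant vector. -/
theorem aux_trace {n : ℕ} (g : EuclideanSpace ℝ (Fin n) → ℝ) (v x : EuclideanSpace ℝ (Fin n))
    (hg : DifferentiableAt ℝ g x) :
    (jacMatrix (fun y => g y • v) x).trace = fderiv ℝ g x v := by
  unfold jacMatrix
  rw [fderiv_smul_const hg]
  have hv : v = ∑ i, v i • (EuclideanSpace.basisFun (Fin n) ℝ) i := by
    have := (EuclideanSpace.basisFun (Fin n) ℝ).sum_repr v
    simpa using this.symm
  conv_rhs => rw [hv, map_sum]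
  simp only [Matrix.trace, Matrix.diag, LinearMap.toMatrix_apply]
  refine Finset.sum_congr rfl fun i _ => ?_
  simp [mul_comm]

/-- Integration by parts against a scalar test function in a constant direction. -/
theorem aux_ibp {n : ℕ} (u f g : EuclideanSpace ℝ (Fin n) → ℝ) (v : EuclideanSpace ℝ (Fin n))
    (hu : ContDiff ℝ 1 u) (hf : ContDiff ℝ 1 f) (hg : ContDiff ℝ 1 g)
    (hgc : HasCompactSupport g) :
    ∫ x, ((1/2) * ((u x)^2 - (f x)^2) * fderiv ℝ g x v + (u x - f x) * (g x * fderiv ℝ f x v))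
      = - ∫ x, g x • (u x * (fderiv ℝ u x v - fderiv ℝ f x v)) := by
  have cu := hu.continuous
  have cf := hf.continuous
  have cg := hg.continuous
  have cu' : Continuous fun x => fderiv ℝ u x v :=
    (hu.continuous_fderiv one_ne_zero).clm_apply continuous_const
  have cf' : Continuous fun x => fderiv ℝ f x v :=
    (hf.continuous_fderiv one_ne_zero).clm_apply continuous_const
  have cg' : Continuous fun x => fderiv ℝ g x v :=
    (hg.continuous_fderiv one_ne_zero).clm_apply continuous_const
  have hgc' : HasCompactSupport fun x => fderiv ℝ g x v := hgc.fderiv_apply ℝ v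
  have du := hu.differentiable one_ne_zero
  have df := hf.differentiable one_ne_zero
  have dg := hg.differentiable one_ne_zero
  have key : ∀ x, fderiv ℝ (fun x => (1/2) * ((u x)^2 - (f x)^2)) x v
      = u x * fderiv ℝ u x v - f x * fderiv ℝ f x v := by
    intro x
    have h := ((((du x).hasFDerivAt.pow 2).sub ((df x).hasFDerivAt.pow 2)).const_mul (1/2 : ℝ))
    have h2 : fderiv ℝ (fun x => (1/2) * ((u x)^2 - (f x)^2)) x = _ := h.fderiv
    rw [h2]
    simp
    ring
  have i1 : Integrable fun x => (u x * fderiv ℝ u x v - f x * fderiv ℝ f x v) * g x :=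
    Continuous.integrable_of_hasCompactSupport (by fun_prop) hgc.mul_left
  have i2 : Integrable fun x => (1/2) * ((u x)^2 - (f x)^2) * fderiv ℝ g x v :=
    Continuous.integrable_of_hasCompactSupport (by fun_prop) hgc'.mul_left
  have i3 : Integrable fun x => (1/2) * ((u x)^2 - (f x)^2) * g x :=
    Continuous.integrable_of_hasCompactSupport (by fun_prop) hgc.mul_left
  have i4 : Integrable fun x => (u x - f x) * (g x * fderiv ℝ f x v) :=
    Continuous.integrable_of_hasCompactSupport (by fun_prop) (hgc.mul_right).mul_left
  have ibp := integral_mul_fderiv_eq_neg_fderiv_mul_of_integrable (μ := volume)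
    (f := fun x => (1/2) * ((u x)^2 - (f x)^2)) (g := g) (v := v)
    (by simpa only [key] using i1) i2 i3
    (fun x _ => (((du x).pow 2).sub ((df x).pow 2)).const_mul _) (fun x _ => dg x)
  simp only [key] at ibp
  rw [integral_add i2 i4, ibp, ← integral_neg, ← integral_neg, ← integral_add i1.fun_neg i4]
  refine integral_congr_ae (Filter.Eventually.of_forall fun x => ?_)
  simp only [smul_eq_mul]
  ring

/-- Characterization of global solutions of the parameterization tracking
problem by stationarity in all compactly supported interior directions, in
the codimension-zero setting: under the normalization `∫_Ω u = ∫_Ω f`,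
the pre-shape derivative vanishes for all compactly supported smooth
directions iff `u = f` on `Ω`. -/
theorem parameterization_tracking_stationary_iff_global {n : ℕ}
    (Ω : Set (EuclideanSpace ℝ (Fin n))) (hΩo : IsOpen Ω)
    (hΩb : Bornology.IsBounded Ω) (hΩc : IsConnected Ω)
    (u f : EuclideanSpace ℝ (Fin n) → ℝ)
    (hu : ContDiff ℝ 1 u) (hf : ContDiff ℝ 1 f)
    (hupos : ∀ x ∈ Ω, 0 < u x)
    (hnorm : ∫ x in Ω, u x = ∫ x in Ω, f x) :
    (∀ V : EuclideanSpace ℝ (Fin n) → EuclideanSpace ℝ (Fin n),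
        ContDiff ℝ (⊤ : ℕ∞) V → HasCompactSupport V → tsupport V ⊆ Ω →
        ∫ x in Ω,
          ((1/2) * ((u x)^2 - (f x)^2) * (jacMatrix V x).trace
            + (u x - f x) * ⟪gradient f x, V x⟫) = 0)
      ↔ ∀ x ∈ Ω, u x = f x := by
  constructor
  swap
  · intro h V _ _ _
    rw [setIntegral_congr_fun (g := fun _ => (0 : ℝ)) hΩo.measurableSet]
    · simp
    · intro x hx
      simp [h x hx]
  intro h
  have du := hu.differentiable one_ne_zero
  have df := hf.differentiable one_ne_zero
  have hder : ∀ v, ∀ x ∈ Ω, fderiv ℝ u x v = fderiv ℝ f x v := by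
    intro v
    have cW : Continuous fun x => u x * (fderiv ℝ u x v - fderiv ℝ f x v) :=
      hu.continuous.mul (((hu.continuous_fderiv one_ne_zero).clm_apply continuous_const).sub
        ((hf.continuous_fderiv one_ne_zero).clm_apply continuous_const))
    have hae : ∀ᵐ x, x ∈ Ω → u x * (fderiv ℝ u x v - fderiv ℝ f x v) = 0 := by
      refine hΩo.ae_eq_zero_of_integral_contDiff_smul_eq_zero
        (cW.locallyIntegrable.locallyIntegrableOn _) ?_
      intro g hg hgc hgs
      have hg1 : ContDiff ℝ 1 g := hg.of_le (by exact_mod_cast le_top)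
      have hss : tsupport (fun y => g y • v) ⊆ tsupport g := tsupport_smul_subset_left g _
      have hV := h (fun y => g y • v) (hg.smul contDiff_const) (hgc.smul_right) (hss.trans hgs)
      have hin : ∀ x, ⟪gradient f x, g x • v⟫ = g x * fderiv ℝ f x v := by
        intro x
        rw [inner_smul_right, ← toDual_gradient, InnerProductSpace.toDual_apply_apply]
      simp only [hin, aux_trace g v _ (hg1.differentiable one_ne_zero _)] at hV
      rw [setIntegral_eq_integral_of_forall_compl_eq_zero] at hV
      · rw [aux_ibp u f g v hu hf hg1 hgc] at hV
        simpa using hV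
      · intro x hx
        have hx' : x ∉ tsupport g := fun hh => hx (hgs hh)
        rw [fderiv_of_notMem_tsupport ℝ hx', image_eq_zero_of_notMem_tsupport hx']
        simp
    have heq := Measure.eqOn_open_of_ae_eq (μ := volume)
      ((ae_restrict_iff' hΩo.measurableSet).2 hae) hΩo cW.continuousOn continuousOn_const
    intro x hx
    have := heq hx
    have := (mul_eq_zero.1 this).resolve_left (hupos x hx).ne'
    linarith
  obtain ⟨a, ha⟩ := hΩo.exists_eq_add_of_fderiv_eq hΩc.isPreconnected du.differentiableOn
    df.differentiableOn (fun x hx => ContinuousLinearMap.ext fun v => hder v x hx)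
  have hfi : IntegrableOn f Ω :=
    (hf.continuous.continuousOn.integrableOn_compact hΩb.isCompact_closure).mono_set subset_closure
  have hfin : volume Ω ≠ ⊤ := hΩb.measure_lt_top.ne
  have hpos : volume Ω ≠ 0 := (hΩo.measure_pos volume hΩc.nonempty).ne'
  rw [setIntegral_congr_fun hΩo.measurableSet ha,
    integral_add hfi (integrableOn_const hfin)] at hnorm
  have ha0 : a = 0 := by
    simp [Measure.real, ENNReal.toReal_eq_zero_iff, hfin, hpos] at hnorm
    exact hnorm
  intro x hx
  simpa [ha0] using ha hx
end

section
/- Let u, v : ℝ → ℝ be continuously differentiable and 2π-periodic with u(θ) > 0 for all θ and ∫₀^{2π} u(θ) dθ = ∫₀^{2π} v(θ) dθ. Then the following are equivalent: (i) for every smooth 2π-periodic w : ℝ → ℝ, ∫₀^{2π} [ ½ ( u(θ)² − v(θ)² ) · w'(θ) + ( u(θ) − v(θ) ) · v'(θ) · w(θ) ] dθ = 0; (ii) u = v. -/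
open Real

lemma periodic_eq_zero_of_trig (h : ℝ → ℝ) (hc : Continuous h)
    (hper : Function.Periodic h (2*π))
    (H : ∀ w : ℝ → ℝ, ContDiff ℝ (⊤ : ℕ∞) w → Function.Periodic w (2*π) →
      ∫ θ in (0:ℝ)..(2*π), h θ * w θ = 0) : ∀ x, h x = 0 := by
  have : Fact (0 < 2*π) := ⟨Real.two_pi_pos⟩
  have hcper : Function.Periodic (fun x => (h x : ℂ)) (2*π) := fun x => by simp [hper x]
  have hcc : Continuous (hcper.lift : AddCircle (2*π) → ℂ) := by
    refine continuous_coinduced_dom.2 ?_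
    exact Complex.continuous_ofReal.comp hc
  let f : C(AddCircle (2*π), ℂ) := ⟨hcper.lift, hcc⟩
  have hf : ∀ x : ℝ, f (x : AddCircle (2*π)) = (h x : ℂ) := fun x => hcper.lift_coe x
  have hpi : (π : ℂ) ≠ 0 := by exact_mod_cast Real.pi_ne_zero
  have hcoef : ∀ n, fourierCoeff f n = 0 := by
    intro n
    rw [fourierCoeff_eq_intervalIntegral _ n 0]
    have e1 : ∫ θ in (0:ℝ)..(2*π), h θ * Real.cos ((-n : ℤ) * θ) = 0 := by
      apply H (fun θ => Real.cos ((-n : ℤ) * θ))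
      · fun_prop
      · intro x
        simp only
        rw [mul_add, Real.cos_add_int_mul_two_pi]
    have e2 : ∫ θ in (0:ℝ)..(2*π), h θ * Real.sin ((-n : ℤ) * θ) = 0 := by
      apply H (fun θ => Real.sin ((-n : ℤ) * θ))
      · fun_prop
      · intro x
        simp only
        rw [mul_add, Real.sin_add_int_mul_two_pi]
    have e : ∀ x : ℝ, fourier (-n) (x : AddCircle (2*π)) • f x
        = ((h x * Real.cos ((-n : ℤ) * x) : ℝ) : ℂ)
          + ((h x * Real.sin ((-n : ℤ) * x) : ℝ) : ℂ) * Complex.I := by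
      intro x
      rw [hf, fourier_coe_apply]
      have : 2 * (π:ℂ) * Complex.I * ((-n : ℤ) : ℂ) * (x:ℂ) / ((2 * π : ℝ) : ℂ)
          = (((-n : ℤ) : ℂ) * x) * Complex.I := by
        push_cast
        field_simp
      rw [this, Complex.exp_mul_I]
      push_cast
      rw [smul_eq_mul]
      ring
    simp_rw [e]
    rw [zero_add, intervalIntegral.integral_add, intervalIntegral.integral_mul_const,
      intervalIntegral.integral_ofReal, intervalIntegral.integral_ofReal, e1, e2]
    · simp
    · apply Continuous.intervalIntegrable
      fun_prop
    · apply Continuous.intervalIntegrable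
      fun_prop
  have hz : fourierCoeff f = 0 := funext hcoef
  have hs := hasSum_fourier_series_of_summable (f := f) (by rw [hz]; exact summable_zero)
  have hf0 : f = 0 := by
    refine hs.unique ?_
    simp [hcoef]
  intro x
  have := hf x
  rw [hf0] at this
  simpa using this.symm

/-- Characterization of global solutions of the parameterization tracking
problem by fiber (tangential-direction) stationarity, written out for the
unit circle: for `2π`-periodic densities `u > 0` and `v` with equal total
mass, the tangential pre-shape derivative vanishes for every smooth
`2π`-periodic tangential coefficient `w` iff `u = v`. -/
theorem parameterization_tracking_circle_stationary_iff_global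
    (u v : ℝ → ℝ) (hu : ContDiff ℝ 1 u) (hv : ContDiff ℝ 1 v)
    (huper : Function.Periodic u (2*π)) (hvper : Function.Periodic v (2*π))
    (hupos : ∀ θ, 0 < u θ)
    (hnorm : ∫ θ in (0:ℝ)..(2*π), u θ = ∫ θ in (0:ℝ)..(2*π), v θ) :
    (∀ w : ℝ → ℝ, ContDiff ℝ (⊤ : ℕ∞) w → Function.Periodic w (2*π) →
        ∫ θ in (0:ℝ)..(2*π),
          ((1/2) * ((u θ)^2 - (v θ)^2) * deriv w θ
            + (u θ - v θ) * deriv v θ * w θ) = 0)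
      ↔ u = v := by
  constructor
  · intro hst
    have du : ∀ x, HasDerivAt u (deriv u x) x := fun x =>
      (hu.differentiable (by norm_num) x).hasDerivAt
    have dv : ∀ x, HasDerivAt v (deriv v x) x := fun x =>
      (hv.differentiable (by norm_num) x).hasDerivAt
    have cu := hu.continuous
    have cv := hv.continuous
    have cdu : Continuous (deriv u) := hu.continuous_deriv (by norm_num)
    have cdv : Continuous (deriv v) := hv.continuous_deriv (by norm_num)
    have pdu : Function.Periodic (deriv u) (2*π) := fun x => by
      rw [← deriv_comp_add_const]; congr 1; exact funext huper
    have pdv : Function.Periodic (deriv v) (2*π) := fun x => by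
      rw [← deriv_comp_add_const]; congr 1; exact funext hvper
    have key := periodic_eq_zero_of_trig (fun x => u x * (deriv u x - deriv v x))
      (by fun_prop) (fun x => by simp only [huper x, pdu x, pdv x]) (by
        intro w hw pw
        have cw := hw.continuous
        have cdw : Continuous (deriv w) := hw.continuous_deriv (by simp)
        have dw : ∀ x, HasDerivAt w (deriv w x) x := fun x =>
          (hw.differentiable (by simp) x).hasDerivAt
        have h1 := hst w hw pw
        have h2 : ∫ θ in (0:ℝ)..(2*π),
            (((1/2) * ((u θ)^2 - (v θ)^2) * deriv w θ
              + (u θ - v θ) * deriv v θ * w θ)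
              + u θ * (deriv u θ - deriv v θ) * w θ) = 0 := by
          rw [intervalIntegral.integral_eq_sub_of_hasDerivAt
            (f := fun θ => (1/2) * ((u θ)^2 - (v θ)^2) * w θ)]
          · have a := huper 0
            have b := hvper 0
            have c := pw 0
            rw [zero_add] at a b c
            simp only [a, b, c, sub_self]
          · intro x _
            have h3 : HasDerivAt (fun θ => (1/2) * ((u θ)^2 - (v θ)^2) * w θ) _ x :=
              ((((du x).pow 2).sub ((dv x).pow 2)).const_mul (1/2)).mul (dw x)
            refine h3.congr_deriv ?_
            simp only [Pi.sub_apply, Pi.pow_apply, Nat.cast_ofNat, Nat.add_one_sub_one, pow_one]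
            ring
          · apply Continuous.intervalIntegrable
            fun_prop
        rw [intervalIntegral.integral_add, h1, zero_add] at h2
        · exact h2
        · apply Continuous.intervalIntegrable
          fun_prop
        · apply Continuous.intervalIntegrable
          fun_prop)
    have hd : ∀ x, deriv (fun y => u y - v y) x = 0 := by
      intro x
      refine (((du x).sub (dv x)).deriv : deriv (fun y => u y - v y) x = _).trans ?_
      exact (mul_eq_zero.1 (key x)).resolve_left (hupos x).ne'
    have hconst : ∀ x, u x - v x = u 0 - v 0 := fun x =>
      is_const_of_deriv_eq_zero (f := fun y => u y - v y)
        (fun x => ((du x).sub (dv x)).differentiableAt) hd x 0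
    have hi : ∫ θ in (0:ℝ)..(2*π), (u θ - v θ) = 0 := by
      rw [intervalIntegral.integral_sub (cu.intervalIntegrable _ _)
        (cv.intervalIntegrable _ _), hnorm, sub_self]
    simp_rw [hconst] at hi
    rw [intervalIntegral.integral_const, smul_eq_mul] at hi
    have h0 : u 0 - v 0 = 0 :=
      (mul_eq_zero.1 hi).resolve_left (by rw [sub_zero]; exact Real.two_pi_pos.ne')
    funext x
    linarith [hconst x]
  · rintro rfl w _ _
    simp
end

section
/- Let γ : ℝ → ℝ² be a continuously differentiable, 2π-periodic curve with γ'(θ) ≠ 0 for all θ (a regular parameterized closed curve), let f : ℝ² → ℝ and V : ℝ² → ℝ² be continuously differentiable, and set τ(θ) = γ'(θ)/‖γ'(θ)‖. Then the function t ↦ ∫₀^{2π} f( γ(θ) + t·V(γ(θ)) ) · ‖γ'(θ) + t·DV(γ(θ))γ'(θ)‖ dθ is differentiable at t = 0 with derivative ∫₀^{2π} [ ⟨∇f(γ(θ)), V(γ(θ))⟩ + f(γ(θ)) · ⟨τ(θ), DV(γ(θ)) τ(θ)⟩ ] · ‖γ'(θ)‖ dθ. -/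
open Real
open scoped RealInnerProductSpace

/-- Pre-shape material derivative rule for boundary integrals, instantiated
for a regular closed curve `γ` in the plane with shape-independent ambient
integrand `f`: with unit tangent `τ(θ) = γ'(θ)/‖γ'(θ)‖` and tangential
divergence `div_Γ V(γ θ) = ⟨τ, DV(γ) τ⟩`, the arc-length integral of `f`
over the perturbed curve `θ ↦ γ(θ) + t·V(γ(θ))` is differentiable at
`t = 0` with derivative `∫_Γ ⟨∇f, V⟩ + f · div_Γ V ds`. -/
theorem material_derivative_curve_integral
    (γ : ℝ → EuclideanSpace ℝ (Fin 2)) (hγ : ContDiff ℝ 1 γ)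
    (hγper : Function.Periodic γ (2*π)) (hγreg : ∀ θ, deriv γ θ ≠ 0)
    (f : EuclideanSpace ℝ (Fin 2) → ℝ) (hf : ContDiff ℝ 1 f)
    (V : EuclideanSpace ℝ (Fin 2) → EuclideanSpace ℝ (Fin 2)) (hV : ContDiff ℝ 1 V)
    (τ : ℝ → EuclideanSpace ℝ (Fin 2)) (hτ : ∀ θ, τ θ = ‖deriv γ θ‖⁻¹ • deriv γ θ) :
    HasDerivAt
      (fun t : ℝ => ∫ θ in (0:ℝ)..(2*π),
        f (γ θ + t • V (γ θ)) * ‖deriv γ θ + t • fderiv ℝ V (γ θ) (deriv γ θ)‖)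
      (∫ θ in (0:ℝ)..(2*π),
        (⟪gradient f (γ θ), V (γ θ)⟫
          + f (γ θ) * ⟪τ θ, fderiv ℝ V (γ θ) (τ θ)⟫) * ‖deriv γ θ‖) 0 := by
  have hg' : Continuous (deriv γ) := hγ.continuous_deriv (le_refl _)
  have hg : Continuous γ := hγ.continuous
  have hfc : Continuous f := hf.continuous
  have hVc : Continuous V := hV.continuous
  have hf' : Continuous (fderiv ℝ f) := hf.continuous_fderiv one_ne_zero
  have hV' : Continuous (fderiv ℝ V) := hV.continuous_fderiv one_ne_zero
  have hA : Continuous (fun θ => fderiv ℝ V (γ θ) (deriv γ θ)) :=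
    (hV'.comp hg).clm_apply hg'
  obtain ⟨A, hAdef⟩ : ∃ A : ℝ → EuclideanSpace ℝ (Fin 2),
      A = fun θ => fderiv ℝ V (γ θ) (deriv γ θ) := ⟨_, rfl⟩
  have hAθ : ∀ θ, fderiv ℝ V (γ θ) (deriv γ θ) = A θ := fun θ => by rw [hAdef]
  rw [← hAdef] at hA
  simp only [hAθ]
  let F' : ℝ → ℝ → ℝ := fun t θ =>
    fderiv ℝ f (γ θ + t • V (γ θ)) (V (γ θ)) * ‖deriv γ θ + t • A θ‖
      + f (γ θ + t • V (γ θ)) * (⟪deriv γ θ + t • A θ, A θ⟫ / ‖deriv γ θ + t • A θ‖)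
  let B : ℝ × ℝ → ℝ := fun p =>
    |fderiv ℝ f (γ p.2 + p.1 • V (γ p.2)) (V (γ p.2))| * ‖deriv γ p.2 + p.1 • A p.2‖
      + |f (γ p.2 + p.1 • V (γ p.2))| * ‖A p.2‖
  have hBc : Continuous B := by
    have h1 : Continuous fun p : ℝ × ℝ =>
        fderiv ℝ f (γ p.2 + p.1 • V (γ p.2)) (V (γ p.2)) :=
      (hf'.comp (by fun_prop)).clm_apply (by fun_prop)
    have h2 : Continuous fun p : ℝ × ℝ => f (γ p.2 + p.1 • V (γ p.2)) := by fun_prop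
    exact (h1.abs.mul (by fun_prop)).add (h2.abs.mul (by fun_prop))
  obtain ⟨C, hC⟩ := ((isCompact_Icc (a := (-1:ℝ)) (b := 1)).prod
    (isCompact_Icc (a := (0:ℝ)) (b := 2*π))).exists_bound_of_continuousOn hBc.continuousOn
  have hne : ∀ᶠ t in nhds (0:ℝ), ∀ θ ∈ Set.Icc (0:ℝ) (2*π), deriv γ θ + t • A θ ≠ 0 := by
    apply isCompact_Icc.eventually_forall_of_forall_eventually
    intro θ _
    have hc : Continuous fun p : ℝ × ℝ => deriv γ p.2 + p.1 • A p.2 := by fun_prop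
    exact hc.continuousAt.eventually_ne (by simpa using hγreg θ)
  have hs : {t : ℝ | (∀ θ ∈ Set.Icc (0:ℝ) (2*π), deriv γ θ + t • A θ ≠ 0) ∧
      t ∈ Set.Icc (-1:ℝ) 1} ∈ nhds (0:ℝ) :=
    hne.and (Icc_mem_nhds (by norm_num) (by norm_num))
  have hsub : ∀ θ, θ ∈ Set.uIoc (0:ℝ) (2*π) → θ ∈ Set.Icc (0:ℝ) (2*π) := by
    intro θ h
    rw [Set.uIoc_of_le (by positivity)] at h
    exact ⟨h.1.le, h.2⟩
  have hF'0 : Continuous (F' 0) := by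
    have h1 : Continuous fun θ : ℝ => fderiv ℝ f (γ θ + (0:ℝ) • V (γ θ)) (V (γ θ)) :=
      (hf'.comp (by fun_prop)).clm_apply (by fun_prop)
    have h2 : Continuous fun θ : ℝ => deriv γ θ + (0:ℝ) • A θ := by fun_prop
    have h3 : Continuous fun θ : ℝ => f (γ θ + (0:ℝ) • V (γ θ)) := by fun_prop
    exact (h1.mul h2.norm).add (h3.mul ((h2.inner hA).div h2.norm
      (fun θ => by simpa using hγreg θ)))
  have key := (intervalIntegral.hasDerivAt_integral_of_dominated_loc_of_deriv_le
    (μ := MeasureTheory.volume) (a := 0) (b := 2*π) (x₀ := (0:ℝ)) (F' := F')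
    (F := fun t θ => f (γ θ + t • V (γ θ)) * ‖deriv γ θ + t • A θ‖)
    (bound := fun _ => C) hs ?_ ?_ ?_ ?_ ?_ ?_).2
  · refine HasDerivAt.congr_deriv key (Eq.symm ?_)
    apply intervalIntegral.integral_congr
    intro θ _
    have hn : ‖deriv γ θ‖ ≠ 0 := norm_ne_zero_iff.mpr (hγreg θ)
    have hgr : ⟪gradient f (γ θ), V (γ θ)⟫ = fderiv ℝ f (γ θ) (V (γ θ)) := by
      simp [gradient]
    simp only [F', hgr, hτ, map_smul, hAθ, zero_smul, add_zero, real_inner_smul_left,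
      real_inner_smul_right]
    field_simp
  · refine Filter.Eventually.of_forall fun t => ?_
    exact Continuous.aestronglyMeasurable (by fun_prop)
  · exact Continuous.intervalIntegrable (by fun_prop) _ _
  · exact hF'0.aestronglyMeasurable
  · refine Filter.Eventually.of_forall fun θ hθ t ht => ?_
    refine le_trans ?_ ((le_abs_self _).trans (hC (t, θ) ⟨ht.2, hsub θ hθ⟩))
    have hn : 0 < ‖deriv γ θ + t • A θ‖ := norm_pos_iff.mpr (ht.1 θ (hsub θ hθ))
    refine (norm_add_le _ _).trans ?_
    simp only [B, norm_mul, norm_div, Real.norm_eq_abs, abs_norm]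
    gcongr
    rw [div_le_iff₀ hn, mul_comm]
    exact abs_real_inner_le_norm _ _
  · exact intervalIntegrable_const
  · refine Filter.Eventually.of_forall fun θ hθ t ht => ?_
    have hw : deriv γ θ + t • A θ ≠ 0 := ht.1 θ (hsub θ hθ)
    have hn : ‖deriv γ θ + t • A θ‖ ≠ 0 := norm_ne_zero_iff.mpr hw
    have hd : ∀ a b : EuclideanSpace ℝ (Fin 2),
        HasDerivAt (fun t : ℝ => a + t • b) b t := fun a b => by
      simpa using ((hasDerivAt_id t).smul_const b).const_add a
    have h1 : HasDerivAt (fun t : ℝ => f (γ θ + t • V (γ θ)))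
        (fderiv ℝ f (γ θ + t • V (γ θ)) (V (γ θ))) t :=
      ((hf.differentiable one_ne_zero) _).hasFDerivAt.comp_hasDerivAt t (hd _ _)
    have h2 : HasDerivAt (fun t : ℝ => ‖deriv γ θ + t • A θ‖)
        (⟪deriv γ θ + t • A θ, A θ⟫ / ‖deriv γ θ + t • A θ‖) t := by
      have h := (hd (deriv γ θ) (A θ)).norm_sq.sqrt (pow_ne_zero 2 hn)
      simp only [Real.sqrt_sq (norm_nonneg _)] at h
      refine h.congr_deriv ?_
      field_simp
    exact h1.mul h2
end
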